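/- arXiv:1211.4368 — 3 statements merged into one kernel-verified Lean document; each statement's English description precedes it below -/
import Mathlib

section
/- (Euler–Lagrange equation in integral form; specialization of Theorem 3 to the time scale T = ℝ.) Let x̂ be a weak local extremizer of L subject to x(a) = x_a and x(b) = x_b. Then there exists a constant c ∈ ℝ such that for all t ∈ [a,b], Σ_{i=1}^{m} H_i'(F_1(x̂),…,F_m(x̂)) · ( f_{iv}(t, x̂(t), x̂'(t)) − ∫_a^t f_{iy}(τ, x̂(τ), x̂'(τ)) dτ ) = c, where F_i(x̂) = ∫_a^b f_i(t, x̂(t), x̂'(t)) dt. -/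
open Set intervalIntegral

/-- Sup norm of `g` over the interval `[a, b]`. -/
noncomputable def supIcc (a b : ℝ) (g : ℝ → ℝ) : ℝ :=
  ⨆ t : Icc a b, |g t.1|

/-- Mean value theorem with an intermediate point not assumed to be strictly interior. -/
lemma exists_mem_uIcc_sub_eq_mul {g g' : ℝ → ℝ} (hg : ∀ x, HasDerivAt g (g' x) x) (u v : ℝ) :
    ∃ ξ ∈ uIcc u v, g v - g u = g' ξ * (v - u) := by
  have hc : Continuous g := continuous_iff_continuousAt.2 fun x => (hg x).continuousAt
  rcases lt_trichotomy u v with h | rfl | h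
  · obtain ⟨ξ, hξ, e⟩ := exists_hasDerivAt_eq_slope g g' h hc.continuousOn fun x _ => hg x
    refine ⟨ξ, Icc_subset_uIcc (Ioo_subset_Icc_self hξ), ?_⟩
    rw [e, div_mul_cancel₀ _ (sub_ne_zero.2 h.ne')]
  · exact ⟨u, left_mem_uIcc, by simp⟩
  · obtain ⟨ξ, hξ, e⟩ := exists_hasDerivAt_eq_slope g g' h hc.continuousOn fun x _ => hg x
    refine ⟨ξ, Icc_subset_uIcc' (Ioo_subset_Icc_self hξ), ?_⟩
    rw [e, div_mul_eq_mul_div, eq_div_iff (sub_ne_zero.2 h.ne')]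
    ring

/-- Chain rule along a curve for a function with continuous partial derivatives. -/
lemma hasDerivAt_comp_of_continuous_partial {ι : Type*} [Fintype ι] [DecidableEq ι]
    {H : (ι → ℝ) → ℝ} {H' : ι → (ι → ℝ) → ℝ}
    (hH : ∀ i z, HasDerivAt (fun s => H (Function.update z i s)) (H' i z) (z i))
    (hH' : ∀ i, Continuous (H' i)) {z : ℝ → ι → ℝ} {z' : ι → ℝ} {s₀ : ℝ}
    (hz : ∀ i, HasDerivAt (fun s => z s i) (z' i) s₀) :
    HasDerivAt (fun s => H (z s)) (∑ i, H' i (z s₀) * z' i) s₀ := by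
  suffices key : ∀ S : Finset ι,
      HasDerivAt (fun s => H (S.piecewise (z s) (z s₀))) (∑ i ∈ S, H' i (z s₀) * z' i) s₀ by
    simpa using key Finset.univ
  intro S
  induction S using Finset.induction_on with
  | empty => simpa using hasDerivAt_const s₀ (H (z s₀))
  | insert j S hj ih =>
    have hw : ∀ s, Function.update (S.piecewise (z s) (z s₀)) j (z s₀ j)
        = S.piecewise (z s) (z s₀) := fun s => by
      rw [Function.update_eq_self_iff, Finset.piecewise_eq_of_notMem _ _ _ hj]
    have hmv : ∀ s, ∃ ξ ∈ uIcc (z s₀ j) (z s j),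
        H ((insert j S).piecewise (z s) (z s₀)) - H (S.piecewise (z s) (z s₀))
          = H' j (Function.update (S.piecewise (z s) (z s₀)) j ξ) * (z s j - z s₀ j) := fun s => by
      have := exists_mem_uIcc_sub_eq_mul
        (g := fun u => H (Function.update (S.piecewise (z s) (z s₀)) j u))
        (g' := fun u => H' j (Function.update (S.piecewise (z s) (z s₀)) j u))
        (fun u => by simpa using hH j (Function.update (S.piecewise (z s) (z s₀)) j u))
        (z s₀ j) (z s j)
      simpa only [hw, Finset.piecewise_insert] using this
    choose ξ hξ e using hmv
    have hzj : Filter.Tendsto (fun s => z s j) (nhds s₀) (nhds (z s₀ j)) :=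
      (hz j).continuousAt
    have hξt : Filter.Tendsto ξ (nhds s₀) (nhds (z s₀ j)) := by
      rw [tendsto_iff_dist_tendsto_zero] at hzj ⊢
      refine squeeze_zero (fun _ => dist_nonneg) (fun s => ?_) hzj
      simpa [Real.dist_eq] using abs_sub_left_of_mem_uIcc (hξ s)
    have hpt : Filter.Tendsto (fun s => Function.update (S.piecewise (z s) (z s₀)) j (ξ s))
        (nhds s₀) (nhds (z s₀)) := by
      rw [tendsto_pi_nhds]
      intro i
      by_cases hij : i = j
      · subst hij
        simpa using hξt
      · by_cases hi : i ∈ S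
        · simpa [hij, hi] using (hz i).continuousAt.tendsto
        · simp [hij, hi]
    have hd : HasDerivAt (fun s => H ((insert j S).piecewise (z s) (z s₀))
        - H (S.piecewise (z s) (z s₀))) (H' j (z s₀) * z' j) s₀ := by
      rw [hasDerivAt_iff_tendsto_slope]
      have h1 := ((((hH' j).tendsto _).comp hpt).mono_left
        (nhdsWithin_le_nhds (s := {s₀}ᶜ))).mul (hasDerivAt_iff_tendsto_slope.1 (hz j))
      refine h1.congr fun s => ?_
      simp only [slope_def_field, Function.comp_apply, e]
      simp [mul_div_assoc]
    rw [Finset.sum_insert hj]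
    exact (hd.add ih).congr_of_eventuallyEq (.of_forall fun s => by simp)

/-- Chain rule along a line for a bivariate function with continuous partial derivatives. -/
lemma hasDerivAt_comp_line_of_continuous_partial {φ φ₁ φ₂ : ℝ → ℝ → ℝ}
    (h₁ : ∀ y v, HasDerivAt (fun y' => φ y' v) (φ₁ y v) y)
    (h₂ : ∀ y v, HasDerivAt (fun v' => φ y v') (φ₂ y v) v)
    (hc₁ : Continuous fun p : ℝ × ℝ => φ₁ p.1 p.2)
    (hc₂ : Continuous fun p : ℝ × ℝ => φ₂ p.1 p.2) (y v η g ε : ℝ) :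
    HasDerivAt (fun e => φ (y + e * η) (v + e * g))
      (φ₁ (y + ε * η) (v + ε * g) * η + φ₂ (y + ε * η) (v + ε * g) * g) ε := by
  have h := hasDerivAt_comp_of_continuous_partial (ι := Fin 2) (H := fun z => φ (z 0) (z 1))
    (H' := ![fun z => φ₁ (z 0) (z 1), fun z => φ₂ (z 0) (z 1)])
    (z := fun e => ![y + e * η, v + e * g]) (z' := ![η, g]) (s₀ := ε)
    (by
      intro i z
      fin_cases i
      · simpa using h₁ (z 0) (z 1)
      · simpa using h₂ (z 0) (z 1))
    (by
      intro i
      fin_cases i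
      · exact hc₁.comp (by fun_prop : Continuous fun z : Fin 2 → ℝ => (z 0, z 1))
      · exact hc₂.comp (by fun_prop : Continuous fun z : Fin 2 → ℝ => (z 0, z 1)))
    (by
      intro i
      fin_cases i
      · simpa using ((hasDerivAt_id ε).mul_const η).const_add y
      · simpa using ((hasDerivAt_id ε).mul_const g).const_add v)
  simpa [Fin.sum_univ_two] using h

/-- First variation of the functional `x ↦ ∫ f(t, x, x')` in the direction `η`, where `g = η'`. -/
lemma hasDerivAt_integral_variation {a b : ℝ} (hab : a ≤ b) {f fy fv : ℝ → ℝ → ℝ → ℝ}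
    (hf : ContinuousOn (fun p : ℝ × ℝ × ℝ => f p.1 p.2.1 p.2.2) (Icc a b ×ˢ univ))
    (hfy : ∀ t ∈ Icc a b, ∀ y v, HasDerivAt (fun y' => f t y' v) (fy t y v) y)
    (hfv : ∀ t ∈ Icc a b, ∀ y v, HasDerivAt (fun v' => f t y v') (fv t y v) v)
    (hfyc : ContinuousOn (fun p : ℝ × ℝ × ℝ => fy p.1 p.2.1 p.2.2) (Icc a b ×ˢ univ))
    (hfvc : ContinuousOn (fun p : ℝ × ℝ × ℝ => fv p.1 p.2.1 p.2.2) (Icc a b ×ˢ univ))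
    {x x' η g : ℝ → ℝ} (hx : ContinuousOn x (Icc a b)) (hx' : ContinuousOn x' (Icc a b))
    (hη : ContinuousOn η (Icc a b)) (hg : ContinuousOn g (Icc a b)) :
    HasDerivAt (fun ε => ∫ t in a..b, f t (x t + ε * η t) (x' t + ε * g t))
      (∫ t in a..b, (fy t (x t) (x' t) * η t + fv t (x t) (x' t) * g t)) 0 := by
  have hpath : ContinuousOn
      (fun q : ℝ × ℝ => (q.2, x q.2 + q.1 * η q.2, x' q.2 + q.1 * g q.2))
      (univ ×ˢ Icc a b) := by
    have hs : MapsTo (Prod.snd : ℝ × ℝ → ℝ) (univ ×ˢ Icc a b) (Icc a b) := fun q hq => hq.2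
    have hsnd : ContinuousOn (Prod.snd : ℝ × ℝ → ℝ) (univ ×ˢ Icc a b) := by fun_prop
    have hfst : ContinuousOn (Prod.fst : ℝ × ℝ → ℝ) (univ ×ˢ Icc a b) := by fun_prop
    exact hsnd.prodMk (((hx.comp hsnd hs).add (hfst.mul (hη.comp hsnd hs))).prodMk
      ((hx'.comp hsnd hs).add (hfst.mul (hg.comp hsnd hs))))
  have hmaps : MapsTo (fun q : ℝ × ℝ => (q.2, x q.2 + q.1 * η q.2, x' q.2 + q.1 * g q.2))
      (univ ×ˢ Icc a b) (Icc a b ×ˢ univ) := fun q hq => ⟨hq.2, mem_univ _⟩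
  have hslice : ∀ (φ : ℝ × ℝ → ℝ), ContinuousOn φ (univ ×ˢ Icc a b) → ∀ ε,
      ContinuousOn (fun t => φ (ε, t)) (Icc a b) := fun φ hφ ε =>
    hφ.comp (by fun_prop) fun t ht => ⟨mem_univ _, ht⟩
  have hF := hf.comp hpath hmaps
  have hF' : ContinuousOn (fun q : ℝ × ℝ =>
      fy q.2 (x q.2 + q.1 * η q.2) (x' q.2 + q.1 * g q.2) * η q.2
        + fv q.2 (x q.2 + q.1 * η q.2) (x' q.2 + q.1 * g q.2) * g q.2) (univ ×ˢ Icc a b) := by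
    have hs : MapsTo (Prod.snd : ℝ × ℝ → ℝ) (univ ×ˢ Icc a b) (Icc a b) := fun q hq => hq.2
    exact ((hfyc.comp hpath hmaps).mul (hη.comp (by fun_prop) hs)).add
      ((hfvc.comp hpath hmaps).mul (hg.comp (by fun_prop) hs))
  obtain ⟨C, hC⟩ := (isCompact_Icc.prod isCompact_Icc :
    IsCompact (Icc (-1 : ℝ) 1 ×ˢ Icc a b)).exists_bound_of_continuousOn
      (hF'.mono (prod_mono (subset_univ _) subset_rfl))
  have hsub : uIoc a b ⊆ Icc a b := by
    rw [uIoc_of_le hab]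
    exact Ioc_subset_Icc_self
  have hcs : ∀ t ∈ Icc a b, Continuous fun p : ℝ × ℝ => (t, p) := fun t _ => by fun_prop
  have h := (intervalIntegral.hasDerivAt_integral_of_dominated_loc_of_deriv_le
    (μ := MeasureTheory.volume) (a := a) (b := b) (x₀ := (0 : ℝ)) (s := Icc (-1) 1)
    (bound := fun _ => C)
    (F := fun ε t => f t (x t + ε * η t) (x' t + ε * g t))
    (F' := fun ε t => fy t (x t + ε * η t) (x' t + ε * g t) * η t
      + fv t (x t + ε * η t) (x' t + ε * g t) * g t)
    (Icc_mem_nhds (by norm_num) (by norm_num))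
    (Filter.Eventually.of_forall fun ε =>
      ((hslice _ hF ε).mono hsub).aestronglyMeasurable measurableSet_uIoc)
    (ContinuousOn.intervalIntegrable (by rw [uIcc_of_le hab]; exact hslice _ hF 0))
    (((hslice _ hF' 0).mono hsub).aestronglyMeasurable measurableSet_uIoc)
    (Filter.Eventually.of_forall fun t ht ε hε => hC (ε, t) ⟨hε, hsub ht⟩)
    intervalIntegrable_const
    (Filter.Eventually.of_forall fun t ht ε _ =>
      hasDerivAt_comp_line_of_continuous_partial (hfy t (hsub ht)) (hfv t (hsub ht))
        (hfyc.comp_continuous (hcs t (hsub ht)) fun _ => ⟨hsub ht, mem_univ _⟩)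
        (hfvc.comp_continuous (hcs t (hsub ht)) fun _ => ⟨hsub ht, mem_univ _⟩) _ _ _ _ _)).2
  simpa using h

/-- The lemma of du Bois-Reymond. -/
lemma exists_sub_integral_eq_const_of_integral_variation_eq_zero {a b : ℝ} (hab : a < b)
    {A B : ℝ → ℝ} (hA : Continuous A) (hB : Continuous B)
    (h : ∀ g : ℝ → ℝ, Continuous g → ∫ t in a..b, g t = 0 →
      ∫ t in a..b, (A t * (∫ s in a..t, g s) + B t * g t) = 0) :
    ∃ c, ∀ t ∈ Icc a b, B t - ∫ s in a..t, A s = c := by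
  have hΦ : ∀ t, HasDerivAt (fun t => ∫ s in a..t, A s) (A t) t := fun t =>
    hA.integral_hasStrictDerivAt a t |>.hasDerivAt
  have hΦc : Continuous fun t => ∫ s in a..t, A s :=
    continuous_iff_continuousAt.2 fun t => (hΦ t).continuousAt
  set G : ℝ → ℝ := fun t => B t - ∫ s in a..t, A s with hG
  have hGc : Continuous G := hB.sub hΦc
  set c : ℝ := (∫ t in a..b, G t) / (b - a) with hc
  have hba : b - a ≠ 0 := (sub_pos.2 hab).ne'
  have hgc : Continuous fun t => G t - c := by fun_prop
  have hg0 : ∫ t in a..b, (G t - c) = 0 := by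
    rw [integral_sub (hGc.intervalIntegrable _ _) intervalIntegrable_const, integral_const, hc,
      smul_eq_mul, mul_div_cancel₀ _ hba, sub_self]
  have hη : ∀ t, HasDerivAt (fun t => ∫ s in a..t, (G s - c)) (G t - c) t := fun t =>
    hgc.integral_hasStrictDerivAt a t |>.hasDerivAt
  have hηc : Continuous fun t => ∫ s in a..t, (G s - c) :=
    continuous_iff_continuousAt.2 fun t => (hη t).continuousAt
  have hparts := integral_mul_deriv_eq_deriv_mul (a := a) (b := b) (fun t _ => hΦ t)
    (fun t _ => hη t) (hA.intervalIntegrable _ _) (hgc.intervalIntegrable _ _)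
  have h0 := h _ hgc hg0
  have hAη : Continuous fun t => A t * ∫ s in a..t, (G s - c) := hA.mul hηc
  have hBg : Continuous fun t => B t * (G t - c) := hB.mul hgc
  have hΦg : Continuous fun t => (∫ s in a..t, A s) * (G t - c) := hΦc.mul hgc
  have hcg : Continuous fun t => c * (G t - c) := continuous_const.mul hgc
  rw [integral_add (hAη.intervalIntegrable _ _) (hBg.intervalIntegrable _ _)] at h0
  rw [hg0, integral_same] at hparts
  have hsq : ∫ t in a..b, (G t - c) ^ 2 = 0 := by
    have e : ∀ t, (G t - c) ^ 2
        = B t * (G t - c) - (∫ s in a..t, A s) * (G t - c) - c * (G t - c) := fun t => by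
      simp only [hG]
      ring
    simp_rw [e]
    rw [integral_sub ((by fun_prop : Continuous fun t =>
        B t * (G t - c) - (∫ s in a..t, A s) * (G t - c)).intervalIntegrable _ _)
      (hcg.intervalIntegrable _ _),
      integral_sub (hBg.intervalIntegrable _ _) (hΦg.intervalIntegrable _ _),
      integral_const_mul, hg0]
    linarith
  refine ⟨c, fun t ht => ?_⟩
  by_contra hne
  have hpos := intervalIntegral.integral_pos hab (hgc.pow 2).continuousOn
    (fun t _ => sq_nonneg (G t - c)) ⟨t, ht, sq_pos_of_ne_zero (sub_ne_zero.2 hne)⟩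
  exact hpos.ne' hsq

/-- The lemma of du Bois-Reymond for functions continuous on `[a, b]` only. -/
lemma ContinuousOn.exists_sub_integral_eq_const_of_integral_variation_eq_zero {a b : ℝ}
    (hab : a < b) {A B : ℝ → ℝ} (hA : ContinuousOn A (Icc a b)) (hB : ContinuousOn B (Icc a b))
    (h : ∀ g : ℝ → ℝ, Continuous g → ∫ t in a..b, g t = 0 →
      ∫ t in a..b, (A t * (∫ s in a..t, g s) + B t * g t) = 0) :
    ∃ c, ∀ t ∈ Icc a b, B t - ∫ s in a..t, A s = c := by
  have hext : ∀ φ : ℝ → ℝ, ∀ t ∈ Icc a b, IccExtend hab.le ((Icc a b).domRestrict φ) t = φ t :=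
    fun φ t ht => by rw [IccExtend_of_mem _ _ ht]; rfl
  obtain ⟨c, hc⟩ := _root_.exists_sub_integral_eq_const_of_integral_variation_eq_zero hab
    (A := IccExtend hab.le ((Icc a b).domRestrict A)) (B := IccExtend hab.le ((Icc a b).domRestrict B))
    (continuousOn_iff_continuous_domRestrict.1 hA).Icc_extend'
    (continuousOn_iff_continuous_domRestrict.1 hB).Icc_extend'
    fun g hg hg0 => by
      rw [← h g hg hg0]
      refine integral_congr fun t ht => ?_
      rw [uIcc_of_le hab.le] at ht
      simp only [hext _ t ht]
  refine ⟨c, fun t ht => ?_⟩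
  rw [← hc t ht, hext B t ht]
  congr 1
  refine integral_congr fun s hs => (hext A s ?_).symm
  rw [uIcc_of_le ht.1] at hs
  exact ⟨hs.1, hs.2.trans ht.2⟩

lemma supIcc_le {a b : ℝ} (hab : a ≤ b) {g : ℝ → ℝ} {C : ℝ} (h : ∀ t ∈ Icc a b, |g t| ≤ C) :
    supIcc a b g ≤ C := by
  have : Nonempty (Icc a b) := ⟨⟨a, left_mem_Icc.2 hab⟩⟩
  exact ciSup_le fun t => h t t.2

/-- Small multiples of a `C¹` function are small in the `C¹` norm. -/
lemma eventually_supIcc_mul_add_supIcc_mul_lt {a b δ : ℝ} (hab : a ≤ b) (hδ : 0 < δ)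
    {η g : ℝ → ℝ} (hη : ContinuousOn η (Icc a b)) (hg : ContinuousOn g (Icc a b)) :
    ∀ᶠ ε : ℝ in nhds 0,
      supIcc a b (fun t => ε * η t) + supIcc a b (fun t => ε * g t) < δ := by
  obtain ⟨M, hM⟩ := isCompact_Icc.exists_bound_of_continuousOn hη
  obtain ⟨N, hN⟩ := isCompact_Icc.exists_bound_of_continuousOn hg
  have hlim : Filter.Tendsto (fun ε : ℝ => |ε| * M + |ε| * N) (nhds 0) (nhds 0) :=
    (by fun_prop : Continuous fun ε : ℝ => |ε| * M + |ε| * N).tendsto' _ _ (by simp)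
  filter_upwards [hlim.eventually_lt_const hδ] with ε hε
  refine (add_le_add (supIcc_le hab fun t ht => ?_) (supIcc_le hab fun t ht => ?_)).trans_lt hε
  · rw [abs_mul]
    exact mul_le_mul_of_nonneg_left (hM t ht) (abs_nonneg _)
  · rw [abs_mul]
    exact mul_le_mul_of_nonneg_left (hN t ht) (abs_nonneg _)

/-- Euler–Lagrange equation in integral form for composition functionals
(specialization of Theorem 3 to the time scale `T = ℝ`). -/
theorem euler_lagrange_integral_form
    (a b : ℝ) (hab : a < b) (m : ℕ) (hm : 1 ≤ m) (xa xb : ℝ)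
    (f fy fv : Fin m → ℝ → ℝ → ℝ → ℝ)
    (H : (Fin m → ℝ) → ℝ) (H' : Fin m → (Fin m → ℝ) → ℝ)
    (hf : ∀ i, ContinuousOn (fun p : ℝ × ℝ × ℝ => f i p.1 p.2.1 p.2.2)
      (Icc a b ×ˢ (univ : Set (ℝ × ℝ))))
    (hfy : ∀ i, ∀ t ∈ Icc a b, ∀ y v : ℝ,
      HasDerivAt (fun y' => f i t y' v) (fy i t y v) y)
    (hfv : ∀ i, ∀ t ∈ Icc a b, ∀ y v : ℝ,
      HasDerivAt (fun v' => f i t y v') (fv i t y v) v)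
    (hfyc : ∀ i, ContinuousOn (fun p : ℝ × ℝ × ℝ => fy i p.1 p.2.1 p.2.2)
      (Icc a b ×ˢ (univ : Set (ℝ × ℝ))))
    (hfvc : ∀ i, ContinuousOn (fun p : ℝ × ℝ × ℝ => fv i p.1 p.2.1 p.2.2)
      (Icc a b ×ˢ (univ : Set (ℝ × ℝ))))
    (hH : ∀ i z, HasDerivAt (fun s => H (Function.update z i s)) (H' i z) (z i))
    (hH' : ∀ i, Continuous (H' i))
    (xh xh' : ℝ → ℝ)
    (hxh : ∀ t ∈ Icc a b, HasDerivAt xh (xh' t) t)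
    (hxhc : ContinuousOn xh' (Icc a b))
    (hxa : xh a = xa) (hxb : xh b = xb)
    (hext : ∃ δ > (0:ℝ),
      (∀ x x' : ℝ → ℝ,
        (∀ t ∈ Icc a b, HasDerivAt x (x' t) t) → ContinuousOn x' (Icc a b) →
        x a = xa → x b = xb →
        supIcc a b (fun t => x t - xh t) + supIcc a b (fun t => x' t - xh' t) < δ →
        H (fun i => ∫ t in a..b, f i t (xh t) (xh' t))
          ≤ H (fun i => ∫ t in a..b, f i t (x t) (x' t))) ∨
      (∀ x x' : ℝ → ℝ,
        (∀ t ∈ Icc a b, HasDerivAt x (x' t) t) → ContinuousOn x' (Icc a b) →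
        x a = xa → x b = xb →
        supIcc a b (fun t => x t - xh t) + supIcc a b (fun t => x' t - xh' t) < δ →
        H (fun i => ∫ t in a..b, f i t (x t) (x' t))
          ≤ H (fun i => ∫ t in a..b, f i t (xh t) (xh' t)))) :
    ∃ c : ℝ, ∀ t ∈ Icc a b,
      ∑ i : Fin m, H' i (fun j => ∫ s in a..b, f j s (xh s) (xh' s)) *
        (fv i t (xh t) (xh' t) - ∫ τ in a..t, fy i τ (xh τ) (xh' τ)) = c := by
  have hxc : ContinuousOn xh (Icc a b) := fun t ht => (hxh t ht).continuousAt.continuousWithinAt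
  have hpath : ContinuousOn (fun t => (t, xh t, xh' t)) (Icc a b) :=
    continuousOn_id.prodMk (hxc.prodMk hxhc)
  have hmaps : MapsTo (fun t => (t, xh t, xh' t)) (Icc a b) (Icc a b ×ˢ univ) :=
    fun t ht => ⟨ht, mem_univ _⟩
  have hY : ∀ i, ContinuousOn (fun t => fy i t (xh t) (xh' t)) (Icc a b) :=
    fun i => (hfyc i).comp hpath hmaps
  have hV : ∀ i, ContinuousOn (fun t => fv i t (xh t) (xh' t)) (Icc a b) :=
    fun i => (hfvc i).comp hpath hmaps
  set l : Fin m → ℝ := fun i => H' i (fun j => ∫ s in a..b, f j s (xh s) (xh' s)) with hl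
  obtain ⟨c, hc⟩ := ContinuousOn.exists_sub_integral_eq_const_of_integral_variation_eq_zero hab
    (A := fun t => ∑ i, l i * fy i t (xh t) (xh' t))
    (B := fun t => ∑ i, l i * fv i t (xh t) (xh' t))
    (continuousOn_finsetSum _ fun i _ => continuousOn_const.mul (hY i))
    (continuousOn_finsetSum _ fun i _ => continuousOn_const.mul (hV i)) (by
      intro g hg hg0
      set η : ℝ → ℝ := fun t => ∫ s in a..t, g s with hη
      have hηd : ∀ t, HasDerivAt η (g t) t := fun t =>
        (hg.integral_hasStrictDerivAt a t).hasDerivAt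
      have hηc : Continuous η := continuous_iff_continuousAt.2 fun t => (hηd t).continuousAt
      have hd := hasDerivAt_comp_of_continuous_partial hH hH' (s₀ := 0)
        (z := fun ε i => ∫ t in a..b, f i t (xh t + ε * η t) (xh' t + ε * g t))
        fun i => hasDerivAt_integral_variation hab.le (hf i) (hfy i) (hfv i) (hfyc i) (hfvc i)
          hxc hxhc hηc.continuousOn hg.continuousOn
      have hadm : ∀ ε : ℝ,
          (∀ t ∈ Icc a b, HasDerivAt (fun t => xh t + ε * η t) (xh' t + ε * g t) t) ∧
          ContinuousOn (fun t => xh' t + ε * g t) (Icc a b) ∧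
          xh a + ε * η a = xa ∧ xh b + ε * η b = xb := fun ε =>
        ⟨fun t ht => (hxh t ht).add ((hηd t).const_mul ε),
          hxhc.add (continuous_const.mul hg).continuousOn,
          by simp [hη, hxa], by simp [hη, hg0, hxb]⟩
      have hextr : IsLocalExtr
          (fun ε => H fun i => ∫ t in a..b, f i t (xh t + ε * η t) (xh' t + ε * g t)) 0 := by
        obtain ⟨δ, hδ, hmin | hmax⟩ := hext
        · left
          filter_upwards [eventually_supIcc_mul_add_supIcc_mul_lt hab.le hδ hηc.continuousOn
            hg.continuousOn] with ε hε
          obtain ⟨h1, h2, h3, h4⟩ := hadm ε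
          simpa using hmin _ _ h1 h2 h3 h4 (by simpa using hε)
        · right
          filter_upwards [eventually_supIcc_mul_add_supIcc_mul_lt hab.le hδ hηc.continuousOn
            hg.continuousOn] with ε hε
          obtain ⟨h1, h2, h3, h4⟩ := hadm ε
          simpa using hmax _ _ h1 h2 h3 h4 (by simpa using hε)
      have h0 := hextr.hasDerivAt_eq_zero hd
      simp only [zero_mul, add_zero] at h0
      simp_rw [← integral_const_mul] at h0
      rw [← integral_finsetSum] at h0
      · rw [← h0]
        refine integral_congr fun t _ => ?_
        simp only [hl, hη]
        rw [Finset.sum_mul, Finset.sum_mul, ← Finset.sum_add_distrib]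
        exact Finset.sum_congr rfl fun i _ => by ring
      · intro i _
        refine ContinuousOn.intervalIntegrable ?_
        rw [uIcc_of_le hab.le]
        exact continuousOn_const.mul
          (((hY i).mul hηc.continuousOn).add ((hV i).mul hg.continuousOn)))
  refine ⟨c, fun t ht => ?_⟩
  rw [← hc t ht, integral_finsetSum]
  · simp only [hl, integral_const_mul, mul_sub, Finset.sum_sub_distrib]
  · intro i _
    refine ContinuousOn.intervalIntegrable ?_
    rw [uIcc_of_le ht.1]
    exact (continuousOn_const.mul (hY i)).mono (Icc_subset_Icc_right ht.2)
end

section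
/- (Euler–Lagrange equation for quotient functionals; specialization of Corollary 1 to the time scale T = ℝ.) Let x̂ be a weak local extremizer of L(x) = (∫_a^b f_1(t, x(t), x'(t)) dt) / (∫_a^b f_2(t, x(t), x'(t)) dt) subject to x(a) = x_a and x(b) = x_b, and set F_1 = ∫_a^b f_1(t, x̂(t), x̂'(t)) dt and F_2 = ∫_a^b f_2(t, x̂(t), x̂'(t)) dt, with F_2 ≠ 0. Then there exists a constant c ∈ ℝ such that for all t ∈ [a,b], (1/F_2) · ( f_{1v}(t, x̂(t), x̂'(t)) − ∫_a^t f_{1y}(τ, x̂(τ), x̂'(τ)) dτ ) − (F_1/F_2²) · ( f_{2v}(t, x̂(t), x̂'(t)) − ∫_a^t f_{2y}(τ, x̂(τ), x̂'(τ)) dτ ) = c. -/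
open Set intervalIntegral

open Filter Topology

theorem supIcc_const_mul (a b c : ℝ) (g : ℝ → ℝ) :
    supIcc a b (fun t => c * g t) = |c| * supIcc a b g := by
  simp only [supIcc, abs_mul]
  exact (Real.mul_iSup_of_nonneg (abs_nonneg c) _).symm

/-- Derivative along a line of a function of two variables with continuous partial derivatives. -/
theorem hasDerivAt_comp_line {g gy gv : ℝ → ℝ → ℝ}
    (hgy : ∀ y v, HasDerivAt (fun y' => g y' v) (gy y v) y)
    (hgv : ∀ y v, HasDerivAt (fun v' => g y v') (gv y v) v)
    (hgyc : Continuous fun p : ℝ × ℝ => gy p.1 p.2)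
    (hgvc : Continuous fun p : ℝ × ℝ => gv p.1 p.2) (y v η h ε : ℝ) :
    HasDerivAt (fun s => g (y + s * η) (v + s * h))
      (gy (y + ε * η) (v + ε * h) * η + gv (y + ε * η) (v + ε * h) * h) ε := by
  have hg := hasStrictFDerivAt_uncurry_coprod (𝕜 := ℝ) (u := (y + ε * η, v + ε * h)) (f := g)
    (f₁ := fun p q => ContinuousLinearMap.toSpanSingleton ℝ (gy p q))
    (f₂ := fun p q => ContinuousLinearMap.toSpanSingleton ℝ (gv p q))
    (Eventually.of_forall fun p => (hgy p.1 p.2).hasFDerivAt)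
    (Eventually.of_forall fun p => (hgv p.1 p.2).hasFDerivAt)
    (((ContinuousLinearMap.toSpanSingletonCLE (𝕜 := ℝ) (E := ℝ)).continuous.comp
      hgyc).continuousAt)
    (((ContinuousLinearMap.toSpanSingletonCLE (𝕜 := ℝ) (E := ℝ)).continuous.comp
      hgvc).continuousAt)
  have hline : HasDerivAt (fun s : ℝ => (y + s * η, v + s * h)) (η, h) ε := by
    have h₁ : HasDerivAt (fun s : ℝ => y + s * η) η ε := by
      simpa using ((hasDerivAt_id ε).mul_const η).const_add y
    have h₂ : HasDerivAt (fun s : ℝ => v + s * h) h ε := by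
      simpa using ((hasDerivAt_id ε).mul_const h).const_add v
    exact h₁.prodMk h₂
  have := HasFDerivAt.comp_hasDerivAt ε hg.hasFDerivAt hline
  refine this.congr_deriv ?_
  simp [Function.HasUncurry.uncurry, mul_comm]

/-- First variation of an integral functional with Lagrangian `f`. -/
theorem hasDerivAt_integral_lagrangian {a b : ℝ} (hab : a ≤ b) {f fy fv : ℝ → ℝ → ℝ → ℝ}
    (hf : ContinuousOn (fun p : ℝ × ℝ × ℝ => f p.1 p.2.1 p.2.2)
      (Icc a b ×ˢ (univ : Set (ℝ × ℝ))))
    (hfy : ∀ t ∈ Icc a b, ∀ y v : ℝ, HasDerivAt (fun y' => f t y' v) (fy t y v) y)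
    (hfv : ∀ t ∈ Icc a b, ∀ y v : ℝ, HasDerivAt (fun v' => f t y v') (fv t y v) v)
    (hfyc : ContinuousOn (fun p : ℝ × ℝ × ℝ => fy p.1 p.2.1 p.2.2)
      (Icc a b ×ˢ (univ : Set (ℝ × ℝ))))
    (hfvc : ContinuousOn (fun p : ℝ × ℝ × ℝ => fv p.1 p.2.1 p.2.2)
      (Icc a b ×ˢ (univ : Set (ℝ × ℝ))))
    {x v η h : ℝ → ℝ} (hx : ContinuousOn x (Icc a b)) (hv : ContinuousOn v (Icc a b))
    (hη : ContinuousOn η (Icc a b)) (hh : ContinuousOn h (Icc a b)) :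
    HasDerivAt (fun ε => ∫ t in a..b, f t (x t + ε * η t) (v t + ε * h t))
      (∫ t in a..b, (fy t (x t) (v t) * η t + fv t (x t) (v t) * h t)) 0 := by
  have hs : ∀ {w : ℝ → ℝ}, ContinuousOn w (Icc a b) →
      ContinuousOn (fun q : ℝ × ℝ => w q.2) ((univ : Set ℝ) ×ˢ Icc a b) := fun hw =>
    hw.comp continuousOn_snd fun q hq => hq.2
  have hcurve : ContinuousOn
      (fun q : ℝ × ℝ => (q.2, x q.2 + q.1 * η q.2, v q.2 + q.1 * h q.2))
      ((univ : Set ℝ) ×ˢ Icc a b) :=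
    continuousOn_snd.prodMk (((hs hx).add (continuousOn_fst.mul (hs hη))).prodMk
      ((hs hv).add (continuousOn_fst.mul (hs hh))))
  have hmaps : MapsTo (fun q : ℝ × ℝ => (q.2, x q.2 + q.1 * η q.2, v q.2 + q.1 * h q.2))
      ((univ : Set ℝ) ×ˢ Icc a b) (Icc a b ×ˢ (univ : Set (ℝ × ℝ))) := fun q hq =>
    ⟨hq.2, mem_univ _⟩
  have hD : ContinuousOn (fun q : ℝ × ℝ =>
      fy q.2 (x q.2 + q.1 * η q.2) (v q.2 + q.1 * h q.2) * η q.2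
        + fv q.2 (x q.2 + q.1 * η q.2) (v q.2 + q.1 * h q.2) * h q.2)
      ((univ : Set ℝ) ×ˢ Icc a b) :=
    ((hfyc.comp hcurve hmaps).mul (hs hη)).add ((hfvc.comp hcurve hmaps).mul (hs hh))
  have hslice : ∀ {G : ℝ × ℝ → ℝ}, ContinuousOn G ((univ : Set ℝ) ×ˢ Icc a b) → ∀ ε : ℝ,
      ContinuousOn (fun t => G (ε, t)) (Icc a b) := fun hG ε =>
    hG.comp (by fun_prop) fun t ht => ⟨mem_univ _, ht⟩
  have hint : ∀ {w : ℝ → ℝ}, ContinuousOn w (Icc a b) →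
      IntervalIntegrable w MeasureTheory.volume a b :=
    fun hw => hw.intervalIntegrable_of_Icc hab
  obtain ⟨C, hC⟩ := ((isCompact_Icc (a := (-1 : ℝ)) (b := 1)).prod
    (isCompact_Icc (a := a) (b := b))).exists_bound_of_continuousOn
      (hD.mono (prod_mono (subset_univ _) subset_rfl))
  have hsub : uIoc a b ⊆ Icc a b := by
    rw [uIoc_of_le hab]; exact Ioc_subset_Icc_self
  have key := hasDerivAt_integral_of_dominated_loc_of_deriv_le (μ := MeasureTheory.volume) (a := a) (b := b)
    (x₀ := (0 : ℝ)) (s := Icc (-1) 1) (bound := fun _ => C)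
    (F := fun ε t => f t (x t + ε * η t) (v t + ε * h t))
    (F' := fun ε t => fy t (x t + ε * η t) (v t + ε * h t) * η t
      + fv t (x t + ε * η t) (v t + ε * h t) * h t)
    (Icc_mem_nhds (by norm_num) (by norm_num))
    (Eventually.of_forall fun ε =>
      (hint (hslice (hf.comp hcurve hmaps) ε)).def'.aestronglyMeasurable)
    (hint (hslice (hf.comp hcurve hmaps) 0))
    (hint (hslice hD 0)).def'.aestronglyMeasurable
    (Eventually.of_forall fun t ht ε hε => hC (ε, t) ⟨hε, hsub ht⟩)
    intervalIntegrable_const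
    (Eventually.of_forall fun t ht ε _ => by
      have hpair : Continuous fun p : ℝ × ℝ => (t, p) := by fun_prop
      exact hasDerivAt_comp_line (hfy t (hsub ht)) (hfv t (hsub ht))
        (hfyc.comp_continuous hpair fun p => ⟨hsub ht, mem_univ _⟩)
        (hfvc.comp_continuous hpair fun p => ⟨hsub ht, mem_univ _⟩) _ _ _ _ ε)
  simpa using key.2

/-- The du Bois-Reymond lemma. -/
theorem du_bois_reymond {a b : ℝ} (hab : a < b) {A B : ℝ → ℝ}
    (hA : ContinuousOn A (Icc a b)) (hB : ContinuousOn B (Icc a b))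
    (H : ∀ η h : ℝ → ℝ, Continuous h → (∀ t, HasDerivAt η (h t) t) → η a = 0 → η b = 0 →
      ∫ t in a..b, (A t * η t + B t * h t) = 0) :
    ∃ c, ∀ t ∈ Icc a b, B t - ∫ τ in a..t, A τ = c := by
  have hA' : Continuous (IccExtend hab.le ((Icc a b).domRestrict A)) :=
    hA.domRestrict.Icc_extend'
  have hB' : Continuous (IccExtend hab.le ((Icc a b).domRestrict B)) :=
    hB.domRestrict.Icc_extend'
  set p := IccExtend hab.le ((Icc a b).domRestrict A) with hp
  set q := IccExtend hab.le ((Icc a b).domRestrict B) with hq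
  have hpA : ∀ t ∈ Icc a b, p t = A t := fun t ht => by
    rw [hp, IccExtend_of_mem _ _ ht]; rfl
  have hqB : ∀ t ∈ Icc a b, q t = B t := fun t ht => by
    rw [hq, IccExtend_of_mem _ _ ht]; rfl
  have hP : ∀ t, HasDerivAt (fun t => ∫ τ in a..t, p τ) (p t) t := fun t =>
    hA'.integral_hasStrictDerivAt a t |>.hasDerivAt
  have hPc : Continuous fun t => ∫ τ in a..t, p τ :=
    continuous_iff_continuousAt.2 fun t => (hP t).continuousAt
  set P : ℝ → ℝ := fun t => ∫ τ in a..t, p τ with hPdef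
  have hgc : Continuous fun t => q t - P t := hB'.sub hPc
  set c : ℝ := (∫ t in a..b, (q t - P t)) / (b - a) with hc
  have hhc : Continuous fun t => q t - P t - c := hgc.sub continuous_const
  have hη : ∀ t, HasDerivAt (fun t => ∫ τ in a..t, (q τ - P τ - c)) (q t - P t - c) t := fun t =>
    hhc.integral_hasStrictDerivAt a t |>.hasDerivAt
  have hηc : Continuous fun t => ∫ τ in a..t, (q τ - P τ - c) :=
    continuous_iff_continuousAt.2 fun t => (hη t).continuousAt
  set η : ℝ → ℝ := fun t => ∫ τ in a..t, (q τ - P τ - c) with hηdef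
  have hηa : η a = 0 := by simp [hηdef]
  have hηb : η b = 0 := by
    have : b - a ≠ 0 := (sub_pos.2 hab).ne'
    simp only [hηdef]
    rw [integral_sub (hgc.intervalIntegrable _ _) (by simp), integral_const, hc, smul_eq_mul]
    field_simp
    ring
  have hvar := H η _ hhc hη hηa hηb
  have hvar' : ∫ t in a..b, (p t * η t + q t * (q t - P t - c)) = 0 := by
    rw [← hvar]
    refine integral_congr fun t ht => ?_
    rw [uIcc_of_le hab.le] at ht
    simp only [hpA t ht, ← hqB t ht]
  have hparts := integral_deriv_mul_eq_sub (a := a) (b := b) (fun t _ => hP t) (fun t _ => hη t)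
    (hA'.intervalIntegrable _ _) (hhc.intervalIntegrable _ _)
  rw [hηa, hηb] at hparts
  have hsq : ∫ t in a..b, (q t - P t - c) ^ 2 = 0 := by
    have h₁ : ∫ t in a..b, (q t - P t - c) = 0 := hηb
    have h₂ : ∀ t, (q t - P t - c) ^ 2 = (p t * η t + q t * (q t - P t - c))
        - (p t * η t + P t * (q t - P t - c)) - c * (q t - P t - c) := fun t => by ring
    simp_rw [h₂]
    rw [integral_sub, integral_sub, hvar', integral_const_mul, h₁, hparts]
    · ring
    all_goals exact Continuous.intervalIntegrable (by fun_prop) _ _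
  refine ⟨c, fun t ht => ?_⟩
  by_contra hne
  have hPt : P t = ∫ τ in a..t, A τ := by
    refine integral_congr fun τ hτ => ?_
    rw [uIcc_of_le ht.1] at hτ
    exact hpA τ ⟨hτ.1, hτ.2.trans ht.2⟩
  have : 0 < ∫ t in a..b, (q t - P t - c) ^ 2 := by
    refine integral_pos hab (by fun_prop) (fun _ _ => sq_nonneg _) ⟨t, ht, ?_⟩
    have : q t - P t - c ≠ 0 := by rwa [hqB t ht, hPt, sub_ne_zero]
    positivity
  exact this.ne' hsq

/-- Euler–Lagrange equation for quotient functionals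
(specialization of Corollary 1 to the time scale `T = ℝ`). -/
theorem euler_lagrange_quotient
    (a b : ℝ) (hab : a < b) (xa xb : ℝ)
    (f₁ f₂ f₁y f₁v f₂y f₂v : ℝ → ℝ → ℝ → ℝ)
    (hf₁ : ContinuousOn (fun p : ℝ × ℝ × ℝ => f₁ p.1 p.2.1 p.2.2)
      (Icc a b ×ˢ (univ : Set (ℝ × ℝ))))
    (hf₂ : ContinuousOn (fun p : ℝ × ℝ × ℝ => f₂ p.1 p.2.1 p.2.2)
      (Icc a b ×ˢ (univ : Set (ℝ × ℝ))))
    (hf₁y : ∀ t ∈ Icc a b, ∀ y v : ℝ, HasDerivAt (fun y' => f₁ t y' v) (f₁y t y v) y)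
    (hf₁v : ∀ t ∈ Icc a b, ∀ y v : ℝ, HasDerivAt (fun v' => f₁ t y v') (f₁v t y v) v)
    (hf₂y : ∀ t ∈ Icc a b, ∀ y v : ℝ, HasDerivAt (fun y' => f₂ t y' v) (f₂y t y v) y)
    (hf₂v : ∀ t ∈ Icc a b, ∀ y v : ℝ, HasDerivAt (fun v' => f₂ t y v') (f₂v t y v) v)
    (hf₁yc : ContinuousOn (fun p : ℝ × ℝ × ℝ => f₁y p.1 p.2.1 p.2.2)
      (Icc a b ×ˢ (univ : Set (ℝ × ℝ))))
    (hf₁vc : ContinuousOn (fun p : ℝ × ℝ × ℝ => f₁v p.1 p.2.1 p.2.2)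
      (Icc a b ×ˢ (univ : Set (ℝ × ℝ))))
    (hf₂yc : ContinuousOn (fun p : ℝ × ℝ × ℝ => f₂y p.1 p.2.1 p.2.2)
      (Icc a b ×ˢ (univ : Set (ℝ × ℝ))))
    (hf₂vc : ContinuousOn (fun p : ℝ × ℝ × ℝ => f₂v p.1 p.2.1 p.2.2)
      (Icc a b ×ˢ (univ : Set (ℝ × ℝ))))
    (xh xh' : ℝ → ℝ)
    (hxh : ∀ t ∈ Icc a b, HasDerivAt xh (xh' t) t)
    (hxhc : ContinuousOn xh' (Icc a b))
    (hxa : xh a = xa) (hxb : xh b = xb)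
    (F₁ F₂ : ℝ)
    (hF₁ : F₁ = ∫ t in a..b, f₁ t (xh t) (xh' t))
    (hF₂ : F₂ = ∫ t in a..b, f₂ t (xh t) (xh' t))
    (hF₂0 : F₂ ≠ 0)
    (hext : ∃ δ > (0:ℝ),
      (∀ x x' : ℝ → ℝ,
        (∀ t ∈ Icc a b, HasDerivAt x (x' t) t) → ContinuousOn x' (Icc a b) →
        x a = xa → x b = xb → (∫ t in a..b, f₂ t (x t) (x' t)) ≠ 0 →
        supIcc a b (fun t => x t - xh t) + supIcc a b (fun t => x' t - xh' t) < δ →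
        F₁ / F₂ ≤ (∫ t in a..b, f₁ t (x t) (x' t)) / ∫ t in a..b, f₂ t (x t) (x' t)) ∨
      (∀ x x' : ℝ → ℝ,
        (∀ t ∈ Icc a b, HasDerivAt x (x' t) t) → ContinuousOn x' (Icc a b) →
        x a = xa → x b = xb → (∫ t in a..b, f₂ t (x t) (x' t)) ≠ 0 →
        supIcc a b (fun t => x t - xh t) + supIcc a b (fun t => x' t - xh' t) < δ →
        (∫ t in a..b, f₁ t (x t) (x' t)) / (∫ t in a..b, f₂ t (x t) (x' t)) ≤ F₁ / F₂)) :
    ∃ c : ℝ, ∀ t ∈ Icc a b,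
      (1 / F₂) * (f₁v t (xh t) (xh' t) - ∫ τ in a..t, f₁y τ (xh τ) (xh' τ))
        - (F₁ / F₂ ^ 2) * (f₂v t (xh t) (xh' t) - ∫ τ in a..t, f₂y τ (xh τ) (xh' τ)) = c := by
  have hxc : ContinuousOn xh (Icc a b) := fun t ht => (hxh t ht).continuousAt.continuousWithinAt
  have hcurve : ContinuousOn (fun t => (t, xh t, xh' t)) (Icc a b) :=
    continuousOn_id.prodMk (hxc.prodMk hxhc)
  have hmaps : MapsTo (fun t => (t, xh t, xh' t)) (Icc a b)
      (Icc a b ×ˢ (univ : Set (ℝ × ℝ))) := fun t ht => ⟨ht, mem_univ _⟩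
  have c₁y : ContinuousOn (fun t => f₁y t (xh t) (xh' t)) (Icc a b) := hf₁yc.comp hcurve hmaps
  have c₁v : ContinuousOn (fun t => f₁v t (xh t) (xh' t)) (Icc a b) := hf₁vc.comp hcurve hmaps
  have c₂y : ContinuousOn (fun t => f₂y t (xh t) (xh' t)) (Icc a b) := hf₂yc.comp hcurve hmaps
  have c₂v : ContinuousOn (fun t => f₂v t (xh t) (xh' t)) (Icc a b) := hf₂vc.comp hcurve hmaps
  have hstat : ∀ η h : ℝ → ℝ, Continuous h → (∀ t, HasDerivAt η (h t) t) → η a = 0 → η b = 0 →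
      ∫ t in a..b,
        ((1 / F₂ * f₁y t (xh t) (xh' t) - F₁ / F₂ ^ 2 * f₂y t (xh t) (xh' t)) * η t
          + (1 / F₂ * f₁v t (xh t) (xh' t) - F₁ / F₂ ^ 2 * f₂v t (xh t) (xh' t)) * h t) = 0 := by
    intro η h hh hη hηa hηb
    have hηc : Continuous η := continuous_iff_continuousAt.2 fun t => (hη t).continuousAt
    have d₁ := hasDerivAt_integral_lagrangian hab.le hf₁ hf₁y hf₁v hf₁yc hf₁vc hxc hxhc
      hηc.continuousOn hh.continuousOn
    have d₂ := hasDerivAt_integral_lagrangian hab.le hf₂ hf₂y hf₂v hf₂yc hf₂vc hxc hxhc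
      hηc.continuousOn hh.continuousOn
    have e₁ : ∫ t in a..b, f₁ t (xh t + 0 * η t) (xh' t + 0 * h t) = F₁ := by simp [hF₁]
    have e₂ : ∫ t in a..b, f₂ t (xh t + 0 * η t) (xh' t + 0 * h t) = F₂ := by simp [hF₂]
    have hquot := d₁.div d₂ (by rwa [e₂])
    obtain ⟨δ, hδ, hext⟩ := hext
    have hne : ∀ᶠ ε in 𝓝 (0 : ℝ),
        ∫ t in a..b, f₂ t (xh t + ε * η t) (xh' t + ε * h t) ≠ 0 :=
      d₂.continuousAt.eventually_ne (by rwa [e₂])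
    have hsmall : ∀ᶠ ε in 𝓝 (0 : ℝ), supIcc a b (fun t => xh t + ε * η t - xh t)
        + supIcc a b (fun t => xh' t + ε * h t - xh' t) < δ := by
      simp only [add_sub_cancel_left, supIcc_const_mul]
      have : Continuous fun ε : ℝ => |ε| * supIcc a b η + |ε| * supIcc a b h := by fun_prop
      exact this.continuousAt.eventually_lt continuousAt_const (by simpa using hδ)
    have hder : ∀ ε : ℝ, ∀ t ∈ Icc a b,
        HasDerivAt (fun t => xh t + ε * η t) (xh' t + ε * h t) t := fun ε t ht =>
      (hxh t ht).add ((hη t).const_mul ε)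
    have hcont : ∀ ε : ℝ, ContinuousOn (fun t => xh' t + ε * h t) (Icc a b) := fun ε =>
      hxhc.add (continuousOn_const.mul hh.continuousOn)
    have hcrit : IsLocalExtr
        ((fun ε => ∫ t in a..b, f₁ t (xh t + ε * η t) (xh' t + ε * h t)) /
          fun ε => ∫ t in a..b, f₂ t (xh t + ε * η t) (xh' t + ε * h t)) 0 := by
      refine hext.imp (fun hmin => ?_) (fun hmax => ?_)
      · filter_upwards [hne, hsmall] with ε hε hε'
        simp only [Pi.div_apply, e₁, e₂]
        exact hmin _ _ (hder ε) (hcont ε) (by simp [hxa, hηa]) (by simp [hxb, hηb]) hε hε'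
      · filter_upwards [hne, hsmall] with ε hε hε'
        simp only [Pi.div_apply, e₁, e₂]
        exact hmax _ _ (hder ε) (hcont ε) (by simp [hxa, hηa]) (by simp [hxb, hηb]) hε hε'
    have hzero := hcrit.hasDerivAt_eq_zero hquot
    rw [e₁, e₂] at hzero
    have hi : ∀ {w : ℝ → ℝ}, ContinuousOn w (Icc a b) →
        IntervalIntegrable w MeasureTheory.volume a b :=
      fun hw => hw.intervalIntegrable_of_Icc hab.le
    have i₁ : IntervalIntegrable (fun t => f₁y t (xh t) (xh' t) * η t
        + f₁v t (xh t) (xh' t) * h t) MeasureTheory.volume a b :=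
      hi ((c₁y.mul hηc.continuousOn).add (c₁v.mul hh.continuousOn))
    have i₂ : IntervalIntegrable (fun t => f₂y t (xh t) (xh' t) * η t
        + f₂v t (xh t) (xh' t) * h t) MeasureTheory.volume a b :=
      hi ((c₂y.mul hηc.continuousOn).add (c₂v.mul hh.continuousOn))
    have hsplit : ∀ t, (1 / F₂ * f₁y t (xh t) (xh' t) - F₁ / F₂ ^ 2 * f₂y t (xh t) (xh' t)) * η t
        + (1 / F₂ * f₁v t (xh t) (xh' t) - F₁ / F₂ ^ 2 * f₂v t (xh t) (xh' t)) * h t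
        = 1 / F₂ * (f₁y t (xh t) (xh' t) * η t + f₁v t (xh t) (xh' t) * h t)
          - F₁ / F₂ ^ 2 * (f₂y t (xh t) (xh' t) * η t + f₂v t (xh t) (xh' t) * h t) :=
      fun t => by ring
    simp_rw [hsplit]
    rw [integral_sub (i₁.const_mul _) (i₂.const_mul _), integral_const_mul, integral_const_mul,
      ← hzero]
    field_simp
  obtain ⟨c, hc⟩ := du_bois_reymond hab
    (A := fun t => 1 / F₂ * f₁y t (xh t) (xh' t) - F₁ / F₂ ^ 2 * f₂y t (xh t) (xh' t))
    (B := fun t => 1 / F₂ * f₁v t (xh t) (xh' t) - F₁ / F₂ ^ 2 * f₂v t (xh t) (xh' t))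
    ((continuousOn_const.mul c₁y).sub (continuousOn_const.mul c₂y))
    ((continuousOn_const.mul c₁v).sub (continuousOn_const.mul c₂v)) hstat
  refine ⟨c, fun t ht => ?_⟩
  have hi : ∀ {w : ℝ → ℝ}, ContinuousOn w (Icc a b) →
      IntervalIntegrable w MeasureTheory.volume a t :=
    fun hw => (hw.mono (Icc_subset_Icc_right ht.2)).intervalIntegrable_of_Icc ht.1
  rw [← hc t ht, integral_sub ((hi c₁y).const_mul _) ((hi c₂y).const_mul _),
    integral_const_mul, integral_const_mul]
  ring
end

section
/- (Example 4, case T = ℝ: the candidate satisfies the Euler–Lagrange equation.) Let Q be a real number with Q³ − 18Q² + 60Q − 72 = 0, and define x_Q : [0,1] → ℝ by x_Q(t) = ((2 + Q)/2) t − (Q/2) t². Set F₁ = ∫_0^1 t x_Q'(t) dt, F₂ = ∫_0^1 x_Q'(t)(1 + t) dt, F₃ = ∫_0^1 (x_Q'(t))² dt. Then there exists a constant c ∈ ℝ such that (F₁F₃ + F₂F₃) t + F₁F₃ + 2 F₁F₂ x_Q'(t) = c for all t ∈ [0,1]. -/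
open Set intervalIntegral

/-- Example 4, case `T = ℝ`: if `Q` satisfies the resolvent cubic, then the
candidate `x_Q(t) = ((2+Q)/2)t − (Q/2)t²` satisfies the Euler–Lagrange
equation of the product functional. -/
theorem example4_real_candidate_EL (Q : ℝ)
    (hQ : Q ^ 3 - 18 * Q ^ 2 + 60 * Q - 72 = 0)
    (x : ℝ → ℝ) (hx : ∀ t : ℝ, x t = ((2 + Q) / 2) * t - (Q / 2) * t ^ 2)
    (F₁ F₂ F₃ : ℝ)
    (hF₁ : F₁ = ∫ t in (0:ℝ)..1, t * deriv x t)
    (hF₂ : F₂ = ∫ t in (0:ℝ)..1, deriv x t * (1 + t))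
    (hF₃ : F₃ = ∫ t in (0:ℝ)..1, (deriv x t) ^ 2) :
    ∃ c : ℝ, ∀ t ∈ Icc (0:ℝ) 1,
      (F₁ * F₃ + F₂ * F₃) * t + F₁ * F₃ + 2 * F₁ * F₂ * deriv x t = c := by
  have hderiv : ∀ t, deriv x t = (2 + Q) / 2 - Q * t := by
    intro t
    have h : HasDerivAt (fun t : ℝ => ((2 + Q) / 2) * t - (Q / 2) * t ^ 2)
        ((2 + Q) / 2 * 1 - Q / 2 * (2 * t)) t := by
      convert! ((hasDerivAt_id t).const_mul ((2 + Q) / 2)).sub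
        ((hasDerivAt_pow 2 t).const_mul (Q / 2)) using 1
      simp
    rw [funext hx, h.deriv]
    ring
  simp only [hderiv] at hF₁ hF₂ hF₃ ⊢
  have integral_quadratic : ∀ a b c : ℝ,
      ∫ t in (0 : ℝ)..1, (a + b * t + c * t ^ 2) = a + b / 2 + c / 3 := by
    intro a b c
    rw [integral_add (Continuous.intervalIntegrable (by fun_prop) _ _)
        (Continuous.intervalIntegrable (by fun_prop) _ _),
      integral_add (Continuous.intervalIntegrable (by fun_prop) _ _)
        (Continuous.intervalIntegrable (by fun_prop) _ _),
      integral_const, integral_const_mul, integral_const_mul, integral_id,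
      integral_pow]
    norm_num
    ring
  have h₁ : F₁ = (6 - Q) / 12 := by
    rw [hF₁]
    convert integral_quadratic 0 ((2 + Q) / 2) (-Q) using 1
    · congr 1; ext t; ring
    · ring
  have h₂ : F₂ = (18 - Q) / 12 := by
    rw [hF₂]
    convert integral_quadratic ((2 + Q) / 2) ((2 + Q) / 2 - Q) (-Q) using 1
    · congr 1; ext t; ring
    · ring
  have h₃ : F₃ = 1 + Q ^ 2 / 12 := by
    rw [hF₃]
    convert integral_quadratic (((2 + Q) / 2) ^ 2) (-(2 + Q) * Q) (Q ^ 2) using 1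
    · congr 1; ext t; ring
    · ring
  refine ⟨F₁ * F₃ + 2 * F₁ * F₂ * ((2 + Q) / 2), fun t _ => ?_⟩
  rw [h₁, h₂, h₃]
  linear_combination (-t / 36) * hQ
end
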